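/- Let m, p, r be positive integers with p dividing m. For every P ∈ APS(m, 2r+1) ∖ APS(m, p, 2r+1) there exists P′ ∈ APS(p, 2r+1) ∖ APS(p, p, 2r+1) such that P = Ψ_{m−p}(P′). -/

import Mathlib

open Finset

/-- `Prec p q` means the colored symbol `p = ξ^{p.1}(p.2)` precedes (is smaller than)
`q = ξ^{q.1}(q.2)`: `a > b`, or (`a = b` and `x > y`). -/
def Prec (p q : ℕ × ℕ) : Prop :=
  q.1 < p.1 ∨ (p.1 = q.1 ∧ q.2 < p.2)

instance : DecidableRel Prec := fun p q => by
  unfold Prec; infer_instance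

/-- `w : ℕ → ℕ × ℕ` (read on positions `1,…,n`) is an element of `Z_m ≀ S_n`:
each entry has color `< m` and norm in `{1,…,n}`, and the norms are pairwise distinct. -/
def IsGenPerm (m n : ℕ) (w : ℕ → ℕ × ℕ) : Prop :=
  (∀ i ∈ Finset.Icc 1 n, (w i).1 < m ∧ (w i).2 ∈ Finset.Icc 1 n) ∧
    Set.InjOn (fun i => (w i).2) (Set.Icc 1 n)

/-- The pinnacle set of the word `w`: values at interior positions `2 ≤ i ≤ n-1`
that strictly dominate both neighbors. -/
def pin (n : ℕ) (w : ℕ → ℕ × ℕ) : Finset (ℕ × ℕ) :=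
  ((Finset.Icc 2 (n - 1)).filter
      (fun i => Prec (w (i - 1)) (w i) ∧ Prec (w (i + 1)) (w i))).image w

/-- `P` is an admissible pinnacle set for `Z_m ≀ S_n`. -/
def IsAdmissible (m n : ℕ) (P : Finset (ℕ × ℕ)) : Prop :=
  ∃ w, IsGenPerm m n w ∧ pin n w = P

/-- `APS m n d` : admissible pinnacle sets for `Z_m ≀ S_n` of cardinality at most `d`. -/
def APS (m n d : ℕ) : Set (Finset (ℕ × ℕ)) :=
  {P | IsAdmissible m n P ∧ P.card ≤ d}

/-- `Ψ_k` : increase every color by `k`, keeping norms. -/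
def PsiSet (k : ℕ) (P : Finset (ℕ × ℕ)) : Finset (ℕ × ℕ) :=
  P.image (fun p => (p.1 + k, p.2))

/-- `ψ_k` : increase the color of every entry of the word by `k`. -/
def psiWord (k : ℕ) (w : ℕ → ℕ × ℕ) : ℕ → ℕ × ℕ :=
  fun i => ((w i).1 + k, (w i).2)

/-- The color sum `ε_w = e_1 + ⋯ + e_n` of a word `w`. -/
def epsSum (n : ℕ) (w : ℕ → ℕ × ℕ) : ℕ :=
  ∑ i ∈ Finset.Icc 1 n, (w i).1

/-- `APSc m p n d` : sets `P` with `#P ≤ d` admitting a witness in the complex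
reflection group `G(m,p,n) = {w ∈ Z_m ≀ S_n : ε_w ≡ 0 (mod p)}`. -/
def APSc (m p n d : ℕ) : Set (Finset (ℕ × ℕ)) :=
  {P | (∃ w, IsGenPerm m n w ∧ p ∣ epsSum n w ∧ pin n w = P) ∧ P.card ≤ d}

theorem Prec.trans {x y z : ℕ × ℕ} (h : Prec x y) (h' : Prec y z) : Prec x z := by
  unfold Prec at *; omega

theorem Prec.asymm {x y : ℕ × ℕ} (h : Prec x y) : ¬ Prec y x := by
  unfold Prec at *; omega

/-- A key turning `Prec` into the strict order of a linear order. -/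
def precKey (x : ℕ × ℕ) : ℕᵒᵈ ×ₗ ℕᵒᵈ :=
  toLex (OrderDual.toDual x.1, OrderDual.toDual x.2)

theorem precKey_lt_iff {x y : ℕ × ℕ} : precKey x < precKey y ↔ Prec x y := by
  simp only [precKey, Prec, Prod.Lex.toLex_lt_toLex, OrderDual.toDual_lt_toDual,
    OrderDual.toDual_inj]

theorem precKey_injective : Function.Injective precKey := by
  rintro ⟨a, b⟩ ⟨c, d⟩ h
  simpa [precKey] using h

/-- A finite set can be listed in increasing order of an injective key. -/
theorem exists_increasing_enumeration {α β : Type*} [Inhabited α] [LinearOrder β] (e : α → β)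
    (s : Finset α) (he : Set.InjOn e s) :
    ∃ f : ℕ → α, (∀ i < #s, f i ∈ s) ∧ (∀ i j, i < j → j < #s → e (f i) < e (f j)) ∧
      ∀ x ∈ s, ∃ i < #s, f i = x := by
  classical
  have hc : #(s.image e) = #s := Finset.card_image_of_injOn he
  let o := (s.image e).orderEmbOfFin hc
  have ho : ∀ i, ∃ x ∈ s, e x = o i := fun i =>
    Finset.mem_image.1 (Finset.orderEmbOfFin_mem (s.image e) hc i)
  choose g hg hge using ho
  refine ⟨fun i => if h : i < #s then g ⟨i, h⟩ else default, ?_, ?_, ?_⟩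
  · intro i hi
    simp only [hi, dif_pos, hg]
  · intro i j hij hj
    simp only [hj, hij.trans hj, dif_pos, hge]
    exact o.strictMono (by simpa using hij)
  · intro x hx
    have hmem : e x ∈ Set.range o := by
      rw [Finset.range_orderEmbOfFin]
      exact Finset.mem_coe.2 (Finset.mem_image_of_mem e hx)
    obtain ⟨i, hi⟩ := hmem
    refine ⟨i, i.2, ?_⟩
    simp only [i.2, dif_pos]
    exact he (hg i) hx ((hge i).trans hi)

/-- A subset with more than `i` elements contains an element whose index is at least `i`. -/
theorem exists_index_ge {α : Type*} {s D : Finset α} {f : ℕ → α}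
    (hf : ∀ x ∈ s, ∃ i < #s, f i = x) (hD : D ⊆ s) {i : ℕ} (hi : i < #D) :
    ∃ l, i ≤ l ∧ l < #s ∧ f l ∈ D := by
  classical
  by_contra! hcon
  have hsub : D ⊆ (Finset.range i).image f := by
    intro x hx
    obtain ⟨l, hl, rfl⟩ := hf x (hD hx)
    refine Finset.mem_image_of_mem f (Finset.mem_range.2 ?_)
    by_contra hil
    exact hcon l (by omega) hl hx
  have := (Finset.card_le_card hsub).trans Finset.card_image_le
  rw [Finset.card_range] at this
  omega

/-- The positions at which `w` has a pinnacle. -/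
def pinPositions (n : ℕ) (w : ℕ → ℕ × ℕ) : Finset ℕ :=
  (Finset.Icc 2 (n - 1)).filter (fun i => Prec (w (i - 1)) (w i) ∧ Prec (w (i + 1)) (w i))

theorem mem_pinPositions {n : ℕ} {w : ℕ → ℕ × ℕ} {i : ℕ} :
    i ∈ pinPositions n w ↔
      (2 ≤ i ∧ i ≤ n - 1) ∧ Prec (w (i - 1)) (w i) ∧ Prec (w (i + 1)) (w i) := by
  simp [pinPositions]

theorem pin_eq_image (n : ℕ) (w : ℕ → ℕ × ℕ) : pin n w = (pinPositions n w).image w := rfl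

/-- A nonempty set of `t` pinnacle positions has at least `t + 1` neighbouring positions,
none of which is a pinnacle position. -/
theorem exists_pinnacle_neighbours {n : ℕ} {w : ℕ → ℕ × ℕ} {T : Finset ℕ}
    (hT : T ⊆ pinPositions n w) (hne : T.Nonempty) :
    ∃ D ⊆ Finset.Icc 1 n \ pinPositions n w, #T < #D ∧ ∀ x ∈ D, ∃ i ∈ T, Prec (w x) (w i) := by
  have hmem := fun i (hi : i ∈ T) => mem_pinPositions.1 (hT hi)
  have hmin := hmem _ (T.min'_mem hne)
  refine ⟨insert (T.min' hne - 1) (T.image (· + 1)), ?_, ?_, ?_⟩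
  · intro x hx
    rw [Finset.mem_insert, Finset.mem_image] at hx
    rw [Finset.mem_sdiff, Finset.mem_Icc, mem_pinPositions]
    rcases hx with rfl | ⟨i, hi, rfl⟩
    · refine ⟨by omega, fun h => hmin.2.1.asymm ?_⟩
      have := h.2.2
      rwa [Nat.sub_add_cancel (by omega)] at this
    · have := hmem i hi
      exact ⟨by omega, fun h => this.2.2.asymm (by simpa using h.2.1)⟩
  · rw [Finset.card_insert_of_notMem, Finset.card_image_of_injective _ (add_left_injective 1)]
    · omega
    · intro h
      obtain ⟨i, hi, h⟩ := Finset.mem_image.1 h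
      have := T.min'_le i hi
      omega
  · intro x hx
    rw [Finset.mem_insert, Finset.mem_image] at hx
    rcases hx with rfl | ⟨i, hi, rfl⟩
    · exact ⟨_, T.min'_mem hne, hmin.2.1⟩
    · exact ⟨i, hi, (hmem i hi).2.2⟩

/-- An alternating word, listing the entries `p 0, …, p (k - 1)` at the positions
`2, 4, …, 2 * k` and the entries `v 0, v 1, …` at all other positions. -/
def zigzag {α : Type*} (k : ℕ) (p v : ℕ → α) (i : ℕ) : α :=
  if i % 2 = 0 ∧ i ≤ 2 * k then p (i / 2 - 1)
  else if i ≤ 2 * k then v (i / 2) else v (i - 1 - k)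

theorem zigzag_peak {α : Type*} {k : ℕ} (p v : ℕ → α) {j : ℕ} (hj : j < k) :
    zigzag k p v (2 * j + 2) = p j := by
  rw [zigzag, if_pos (by omega)]
  congr 1
  omega

theorem zigzag_valley {α : Type*} {k : ℕ} (p v : ℕ → α) {j : ℕ} (hj : j ≤ k) :
    zigzag k p v (2 * j + 1) = v j := by
  rw [zigzag, if_neg (by omega)]
  split_ifs <;> congr 1 <;> omega

theorem zigzag_tail {α : Type*} {k : ℕ} (p v : ℕ → α) {i : ℕ} (hi : 2 * k < i) :
    zigzag k p v i = v (i - 1 - k) := by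
  rw [zigzag, if_neg (by omega), if_neg (by omega)]

theorem zigzag_comp {α β : Type*} (k : ℕ) (p v : ℕ → α) (g : α → β) (i : ℕ) :
    g (zigzag k p v i) = zigzag k (fun j => g (p j)) (fun j => g (v j)) i := by
  unfold zigzag
  split_ifs <;> rfl

/-- Every position is a peak of the zigzag, an early valley, or belongs to its tail. -/
theorem zigzag_cases (k : ℕ) {i : ℕ} (hi : 1 ≤ i) :
    (∃ j < k, i = 2 * j + 2) ∨ (∃ j < k, i = 2 * j + 1) ∨ 2 * k < i := by
  by_cases h : 2 * k < i
  · exact Or.inr (Or.inr h)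
  · rcases Nat.even_or_odd' i with ⟨j, rfl | rfl⟩
    · exact Or.inl ⟨j - 1, by omega, by omega⟩
    · exact Or.inr (Or.inl ⟨j, by omega, rfl⟩)

theorem zigzag_exists_valley {k n : ℕ} (hk : 2 * k + 1 ≤ n) {i : ℕ} (hi : 1 ≤ i) (hin : i ≤ n) :
    (∃ j < k, i = 2 * j + 2) ∨
      ∃ l < n - k, ∀ {α : Type} (p v : ℕ → α), zigzag k p v i = v l := by
  rcases zigzag_cases k hi with h | ⟨j, hj, rfl⟩ | h
  · exact Or.inl h
  · exact Or.inr ⟨j, by omega, fun p v => zigzag_valley p v hj.le⟩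
  · exact Or.inr ⟨i - 1 - k, by omega, fun p v => zigzag_tail p v h⟩

theorem zigzag_index_injOn {n k : ℕ} {a b : ℕ → ℕ}
    (ha : Set.InjOn a (Set.Iio k)) (hb : Set.InjOn b (Set.Iio (n - k)))
    (hab : ∀ i < k, ∀ j < n - k, a i ≠ b j) (hk : 2 * k + 1 ≤ n) :
    Set.InjOn (zigzag k a b) (Set.Icc 1 n) := by
  rintro x ⟨hx1, hxn⟩ y ⟨hy1, hyn⟩ hxy
  rcases zigzag_cases k hx1 with ⟨j, hj, rfl⟩ | ⟨j, hj, rfl⟩ | hx <;>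
  rcases zigzag_cases k hy1 with ⟨l, hl, rfl⟩ | ⟨l, hl, rfl⟩ | hy
  · rw [zigzag_peak _ _ hj, zigzag_peak _ _ hl] at hxy
    rw [ha hj hl hxy]
  · rw [zigzag_peak _ _ hj, zigzag_valley _ _ hl.le] at hxy
    exact absurd hxy (hab _ hj _ (by omega))
  · rw [zigzag_peak _ _ hj, zigzag_tail _ _ hy] at hxy
    exact absurd hxy (hab _ hj _ (by omega))
  · rw [zigzag_valley _ _ hj.le, zigzag_peak _ _ hl] at hxy
    exact absurd hxy.symm (hab _ hl _ (by omega))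
  · rw [zigzag_valley _ _ hj.le, zigzag_valley _ _ hl.le] at hxy
    have := hb (Set.mem_Iio.2 (by omega)) (Set.mem_Iio.2 (by omega)) hxy
    omega
  · rw [zigzag_valley _ _ hj.le, zigzag_tail _ _ hy] at hxy
    have := hb (Set.mem_Iio.2 (by omega)) (Set.mem_Iio.2 (by omega)) hxy
    omega
  · rw [zigzag_tail _ _ hx, zigzag_peak _ _ hl] at hxy
    exact absurd hxy.symm (hab _ hl _ (by omega))
  · rw [zigzag_tail _ _ hx, zigzag_valley _ _ hl.le] at hxy
    have := hb (Set.mem_Iio.2 (by omega)) (Set.mem_Iio.2 (by omega)) hxy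
    omega
  · rw [zigzag_tail _ _ hx, zigzag_tail _ _ hy] at hxy
    have := hb (Set.mem_Iio.2 (by omega)) (Set.mem_Iio.2 (by omega)) hxy
    omega

/-- If the valleys increase and each `p j` dominates `v (j + 1)`, then the pinnacles of the
zigzag are exactly its peaks. -/
theorem pin_zigzag {n k : ℕ} {p v : ℕ → ℕ × ℕ} (hk : 2 * k + 1 ≤ n)
    (hv : ∀ i j, i < j → j < n - k → Prec (v i) (v j))
    (hvp : ∀ j < k, Prec (v (j + 1)) (p j)) :
    pin n (zigzag k p v) = (Finset.range k).image p := by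
  have hpeak : ∀ j < k, 2 * j + 2 ∈ pinPositions n (zigzag k p v) := by
    intro j hj
    rw [mem_pinPositions, zigzag_peak p v hj, show 2 * j + 2 - 1 = 2 * j + 1 by omega,
      zigzag_valley p v hj.le, show 2 * j + 2 + 1 = 2 * (j + 1) + 1 by omega,
      zigzag_valley p v hj]
    exact ⟨by omega, (hv j (j + 1) (by omega) (by omega)).trans (hvp j hj), hvp j hj⟩
  rw [pin_eq_image]
  ext x
  simp only [Finset.mem_image, Finset.mem_range]
  constructor
  · rintro ⟨i, hi, rfl⟩
    have hi' := mem_pinPositions.1 hi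
    rcases zigzag_cases k (i := i) (by omega) with ⟨j, hj, rfl⟩ | ⟨j, hj, rfl⟩ | h
    · exact ⟨j, hj, (zigzag_peak p v hj).symm⟩
    · have := (mem_pinPositions.1 (hpeak (j - 1) (by omega))).2.2
      rw [show 2 * (j - 1) + 2 = 2 * j + 1 - 1 by omega,
        show 2 * j + 1 - 1 + 1 = 2 * j + 1 by omega] at this
      exact absurd hi'.2.1 this.asymm
    · have := hv (i - 1 - k) (i + 1 - 1 - k) (by omega) (by omega)
      rw [← zigzag_tail p v h, ← zigzag_tail p v (show 2 * k < i + 1 by omega)] at this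
      exact absurd hi'.2.2 this.asymm
  · rintro ⟨j, hj, rfl⟩
    exact ⟨_, hpeak j hj, zigzag_peak p v hj⟩

/-- Every admissible pinnacle set has a witness whose other entries all have the largest color,
and whose last two entries either increase, or start with the largest pinnacle. -/
theorem IsAdmissible.exists_sorted_witness {m n : ℕ} {P : Finset (ℕ × ℕ)} (hn : 2 ≤ n)
    (hP : IsAdmissible m n P) :
    ∃ w, IsGenPerm m n w ∧ pin n w = P ∧ (∀ i ∈ Finset.Icc 1 n, w i ∈ P ∨ (w i).1 = m - 1) ∧
      (w n).1 = m - 1 ∧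
      (Prec (w (n - 1)) (w n) ∨
        (Prec (w n) (w (n - 1)) ∧ ∀ q ∈ P, (w (n - 1)).1 ≤ q.1)) := by
  obtain ⟨u, ⟨hu, huinj⟩, rfl⟩ := hP
  set S := pinPositions n u
  have hSn : S ⊆ Finset.Icc 1 n := by
    intro i hi
    have := mem_pinPositions.1 hi
    rw [Finset.mem_Icc]
    omega
  have hSn' : (S : Set ℕ) ⊆ Set.Icc 1 n := fun i hi => by simpa using hSn hi
  have hVn : ((Finset.Icc 1 n \ S : Finset ℕ) : Set ℕ) ⊆ Set.Icc 1 n := fun i hi => by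
    simpa using (Finset.mem_sdiff.1 hi).1
  have huS : Set.InjOn u S := fun x hx y hy h =>
    huinj (hSn' hx) (hSn' hy) (congrArg Prod.snd h)
  obtain ⟨a, haS, hau, haS'⟩ := exists_increasing_enumeration (fun i => precKey (u i)) S
    (fun x hx y hy h => huS hx hy (precKey_injective h))
  obtain ⟨b, hbS, hbu, hbS'⟩ := exists_increasing_enumeration
    (fun i => OrderDual.toDual (u i).2) (Finset.Icc 1 n \ S)
    (fun x hx y hy h => huinj (hVn hx) (hVn hy) (OrderDual.toDual.injective h))
  have hcardV : #(Finset.Icc 1 n \ S) = n - #S := by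
    rw [Finset.card_sdiff_of_subset hSn]
    simp
  rw [hcardV] at hbS hbu hbS'
  simp only [precKey_lt_iff] at hau
  simp only [OrderDual.toDual_lt_toDual] at hbu
  set k := #S
  have ha : Set.InjOn a (Set.Iio k) := by
    intro i hi j hj h
    rcases lt_trichotomy i j with hij | hij | hij
    · have := hau i j hij hj
      rw [h] at this
      exact absurd this this.asymm
    · exact hij
    · have := hau j i hij hi
      rw [h] at this
      exact absurd this this.asymm
  have hb : Set.InjOn b (Set.Iio (n - k)) := by
    intro i hi j hj h
    rcases lt_trichotomy i j with hij | hij | hij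
    · have := hbu i j hij hj
      rw [h] at this
      omega
    · exact hij
    · have := hbu j i hij hi
      rw [h] at this
      omega
  -- the `j + 1` smallest pinnacles dominate at least `j + 2` other entries
  have hrank : ∀ j < k, j + 1 < n - k ∧ Prec (m - 1, (u (b (j + 1))).2) (u (a j)) := by
    intro j hj
    have hT : (Finset.range (j + 1)).image a ⊆ S := by
      intro x hx
      obtain ⟨i, hi, rfl⟩ := Finset.mem_image.1 hx
      exact haS i (by have := Finset.mem_range.1 hi; omega)
    obtain ⟨D, hD, hcard, hDP⟩ := exists_pinnacle_neighbours hT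
      ⟨a 0, Finset.mem_image_of_mem a (by simp)⟩
    rw [Finset.card_image_of_injOn (ha.mono (fun x hx => by
      have : x < j + 1 := by simpa using hx
      exact Set.mem_Iio.2 (by omega))), Finset.card_range] at hcard
    obtain ⟨l, hl, hln, hlD⟩ := exists_index_ge (by rw [hcardV]; exact hbS') hD hcard
    rw [hcardV] at hln
    refine ⟨by omega, ?_⟩
    obtain ⟨_, hx, hprec⟩ := hDP _ hlD
    obtain ⟨i, hi, rfl⟩ := Finset.mem_image.1 hx
    have hij : Prec (u (b l)) (u (a j)) := by
      rcases (Nat.lt_succ_iff.1 (Finset.mem_range.1 hi)).eq_or_lt with rfl | h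
      · exact hprec
      · exact hprec.trans (hau i j h hj)
    have hnorm : (u (b l)).2 ≤ (u (b (j + 1))).2 := by
      rcases hl.eq_or_lt with rfl | h
      · exact le_rfl
      · exact (hbu _ _ h hln).le
    have hcol := (hu (b l) (Finset.mem_sdiff.1 (hbS l hln)).1).1
    unfold Prec at hij ⊢
    dsimp only at hij ⊢
    omega
  have hk : 2 * k + 1 ≤ n := by
    rcases Nat.eq_zero_or_pos k with h | h
    · omega
    · have := (hrank (k - 1) (by omega)).1
      omega
  let p : ℕ → ℕ × ℕ := fun j => u (a j)
  let v : ℕ → ℕ × ℕ := fun j => (m - 1, (u (b j)).2)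
  have hv : ∀ i j, i < j → j < n - k → Prec (v i) (v j) := fun i j hij hj =>
    Or.inr ⟨rfl, hbu i j hij hj⟩
  have himage : (Finset.range k).image p = pin n u := by
    rw [pin_eq_image]
    ext x
    simp only [Finset.mem_image, Finset.mem_range]
    constructor
    · rintro ⟨j, hj, rfl⟩
      exact ⟨a j, haS j hj, rfl⟩
    · rintro ⟨i, hi, rfl⟩
      obtain ⟨j, hj, rfl⟩ := haS' i hi
      exact ⟨j, hj, rfl⟩
  have hm : 0 < m := by
    have := (hu 1 (Finset.mem_Icc.2 (by omega))).1
    omega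
  have hnorm : ∀ i, (zigzag k p v i).2 = (u (zigzag k a b i)).2 := fun i => by
    rw [zigzag_comp k p v Prod.snd, zigzag_comp k a b (fun x => (u x).2)]
  have hmaps : ∀ i ∈ Finset.Icc 1 n, zigzag k a b i ∈ Finset.Icc 1 n := by
    intro i hi
    rw [Finset.mem_Icc] at hi
    rcases zigzag_exists_valley hk hi.1 hi.2 with ⟨j, hj, rfl⟩ | ⟨l, hl, h⟩
    · rw [zigzag_peak a b hj]
      exact hSn (haS j hj)
    · rw [h a b]
      exact (Finset.mem_sdiff.1 (hbS l hl)).1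
  have hlast : zigzag k p v n = v (n - 1 - k) := zigzag_tail p v (by omega)
  refine ⟨zigzag k p v, ⟨fun i hi => ⟨?_, ?_⟩, ?_⟩, ?_, fun i hi => ?_, ?_, ?_⟩
  · rw [Finset.mem_Icc] at hi
    rcases zigzag_exists_valley hk hi.1 hi.2 with ⟨j, hj, rfl⟩ | ⟨l, hl, h⟩
    · rw [zigzag_peak p v hj]
      exact (hu _ (hSn (haS j hj))).1
    · rw [h p v]
      exact Nat.sub_lt hm one_pos
  · rw [hnorm]
    exact (hu _ (hmaps i hi)).2
  · intro i hi j hj hij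
    have hij : (zigzag k p v i).2 = (zigzag k p v j).2 := hij
    rw [hnorm, hnorm] at hij
    refine zigzag_index_injOn ha hb (fun i hi j hj h => ?_) hk hi hj (huinj ?_ ?_ hij)
    · exact (Finset.mem_sdiff.1 (hbS j hj)).2 (h ▸ haS i hi)
    · simpa using hmaps i (by simpa using hi)
    · simpa using hmaps j (by simpa using hj)
  · rw [pin_zigzag hk hv (fun j hj => (hrank j hj).2), himage]
  · rw [Finset.mem_Icc] at hi
    rcases zigzag_exists_valley hk hi.1 hi.2 with ⟨j, hj, rfl⟩ | ⟨l, hl, h⟩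
    · left
      rw [zigzag_peak p v hj, ← himage]
      exact Finset.mem_image_of_mem p (Finset.mem_range.2 hj)
    · right
      rw [h p v]
  · rw [hlast]
  · rcases hk.eq_or_lt with h | h
    · right
      have hpk : zigzag k p v (n - 1) = p (k - 1) := by
        rw [show n - 1 = 2 * (k - 1) + 2 by omega, zigzag_peak p v (by omega)]
      have hlast' := (hrank (k - 1) (by omega)).2
      rw [hlast, hpk, ← himage]
      refine ⟨?_, fun q hq => ?_⟩
      · rwa [show k - 1 + 1 = n - 1 - k by omega] at hlast'
      · obtain ⟨j, hj, rfl⟩ := Finset.mem_image.1 hq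
        rw [Finset.mem_range] at hj
        rcases (Nat.le_sub_one_of_lt hj).eq_or_lt with rfl | hjk
        · exact le_rfl
        · have := hau j (k - 1) hjk (by omega)
          simp only [p]
          unfold Prec at this
          omega
    · left
      rw [hlast, zigzag_tail p v (by omega)]
      exact hv _ _ (by omega) (by omega)

theorem pin_congr {n : ℕ} {w w' : ℕ → ℕ × ℕ}
    (h : ∀ i ∈ Finset.Icc 2 (n - 1), w i = w' i ∧
      (Prec (w (i - 1)) (w i) ∧ Prec (w (i + 1)) (w i) ↔
      Prec (w' (i - 1)) (w' i) ∧ Prec (w' (i + 1)) (w' i))) :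
    pin n w = pin n w' := by
  unfold pin
  rw [Finset.filter_congr (fun i hi => (h i hi).2)]
  exact Finset.image_congr fun i hi => (h i (Finset.mem_filter.1 hi).1).1

/-- The last entry may be recolored when this keeps its comparison with the previous entry. -/
theorem pin_update_last {n : ℕ} {w : ℕ → ℕ × ℕ} {x : ℕ × ℕ} (hn : 2 ≤ n)
    (h : Prec x (w (n - 1)) ↔ Prec (w n) (w (n - 1))) :
    pin n (Function.update w n x) = pin n w := by
  refine pin_congr fun i hi => ?_
  rw [Finset.mem_Icc] at hi
  rw [Function.update_of_ne (by omega), Function.update_of_ne (by omega)]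
  refine ⟨rfl, and_congr_right fun _ => ?_⟩
  by_cases hin : i + 1 = n
  · obtain rfl : i = n - 1 := by omega
    rw [hin, Function.update_self, h]
  · rw [Function.update_of_ne hin]

theorem isGenPerm_update_last {m n c : ℕ} {w : ℕ → ℕ × ℕ} (hw : IsGenPerm m n w) (hc : c < m) :
    IsGenPerm m n (Function.update w n (c, (w n).2)) := by
  have hnorm : ∀ i, (Function.update w n (c, (w n).2) i).2 = (w i).2 := by
    intro i
    by_cases h : i = n
    · subst h; simp
    · rw [Function.update_of_ne h]
  refine ⟨fun i hi => ⟨?_, ?_⟩, ?_⟩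
  · by_cases h : i = n
    · subst h; simpa using hc
    · rw [Function.update_of_ne h]
      exact (hw.1 i hi).1
  · rw [hnorm]
    exact (hw.1 i hi).2
  · simpa only [hnorm] using hw.2

theorem epsSum_update_last {n : ℕ} (w : ℕ → ℕ × ℕ) (x : ℕ × ℕ) (hn : 1 ≤ n) :
    epsSum n (Function.update w n x) = epsSum (n - 1) w + x.1 := by
  obtain ⟨k, rfl⟩ : ∃ k, n = k + 1 := ⟨n - 1, by omega⟩
  unfold epsSum
  rw [Finset.sum_Icc_succ_top (by omega), Function.update_self, Nat.add_sub_cancel]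
  congr 1
  refine Finset.sum_congr rfl fun i hi => ?_
  rw [Function.update_of_ne]
  have := Finset.mem_Icc.1 hi
  omega

theorem prec_add_color_iff (k : ℕ) (x y : ℕ × ℕ) :
    Prec (x.1 + k, x.2) (y.1 + k, y.2) ↔ Prec x y := by
  unfold Prec
  dsimp only
  omega

theorem pin_psiWord (n k : ℕ) (w : ℕ → ℕ × ℕ) :
    pin n (psiWord k w) = PsiSet k (pin n w) := by
  unfold pin PsiSet
  rw [Finset.image_image]
  unfold psiWord
  simp only [prec_add_color_iff]
  rfl

theorem isGenPerm_psiWord {p n : ℕ} {w : ℕ → ℕ × ℕ} (k : ℕ) (hw : IsGenPerm p n w) :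
    IsGenPerm (p + k) n (psiWord k w) :=
  ⟨fun i hi => ⟨Nat.add_lt_add_right (hw.1 i hi).1 k, (hw.1 i hi).2⟩, hw.2⟩

theorem epsSum_psiWord (n k : ℕ) (w : ℕ → ℕ × ℕ) :
    epsSum n (psiWord k w) = epsSum n w + n * k := by
  simp [epsSum, psiWord, Finset.sum_add_distrib]

theorem card_psiSet (k : ℕ) (P : Finset (ℕ × ℕ)) : #(PsiSet k P) = #P := by
  refine Finset.card_image_of_injective _ ?_
  rintro ⟨a, b⟩ ⟨c, d⟩ h
  simpa using h

/-- Any residue class modulo `p` meets any interval of `p` consecutive integers. -/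
theorem exists_dvd_add {p : ℕ} (hp : 1 ≤ p) (s N : ℕ) : ∃ c, N ≤ c ∧ c < N + p ∧ p ∣ s + c := by
  have hdm := Nat.div_add_mod (s + N + (p - 1)) p
  have hlt := Nat.mod_lt (s + N + (p - 1)) hp
  refine ⟨N + (p - 1) - (s + N + (p - 1)) % p, by omega, by omega,
    (s + N + (p - 1)) / p, by omega⟩

/-- Every element of `APS(m,2r+1) ∖ APS(m,p,2r+1)` is `Ψ_{m-p}` of an element of
`APS(p,2r+1) ∖ APS(p,p,2r+1)`. -/
theorem complement_surjective (m p r : ℕ) (hp : 1 ≤ p) (hr : 1 ≤ r) (hpm : p ∣ m)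
    (P : Finset (ℕ × ℕ))
    (hP : P ∈ APS m (2 * r + 1) r \ APSc m p (2 * r + 1) r) :
    ∃ P' ∈ APS p (2 * r + 1) r \ APSc p p (2 * r + 1) r,
      P = PsiSet (m - p) P' := by
  obtain ⟨⟨hadm, hcard⟩, hnot⟩ := hP
  obtain ⟨w, hw, hpin, hcol, hlastcol, hlast⟩ := hadm.exists_sorted_witness (by omega)
  have hm : 0 < m := by
    have := (hw.1 1 (Finset.mem_Icc.2 (by omega))).1
    omega
  have hple : p ≤ m := Nat.le_of_dvd hm hpm
  obtain ⟨c, hc1, hc2, hdvd⟩ := exists_dvd_add hp (epsSum (2 * r + 1 - 1) w) (m - p)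
  have hnotpin : pin (2 * r + 1) (Function.update w (2 * r + 1) (c, (w (2 * r + 1)).2)) ≠ P := by
    intro h
    refine hnot ⟨⟨_, isGenPerm_update_last hw (by omega), ?_, h⟩, hcard⟩
    rwa [epsSum_update_last _ _ (by omega)]
  have hlarge : ∀ q ∈ P, m - p ≤ q.1 := by
    intro q hq
    by_contra! hlt
    refine hnotpin ((pin_update_last (by omega) ?_).trans hpin)
    rcases hlast with h | ⟨h, hmin⟩
    · refine iff_of_false (Prec.asymm ?_) h.asymm
      unfold Prec at h ⊢
      dsimp only
      omega
    · refine iff_of_true ?_ h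
      have := hmin q hq
      exact Or.inl (by dsimp only; omega)
  have hcol' : ∀ i ∈ Finset.Icc 1 (2 * r + 1), m - p ≤ (w i).1 := by
    intro i hi
    rcases hcol i hi with h | h
    · exact hlarge _ h
    · omega
  let w' : ℕ → ℕ × ℕ := fun i => ((w i).1 - (m - p), (w i).2)
  have hww' : ∀ i ∈ Finset.Icc 1 (2 * r + 1), psiWord (m - p) w' i = w i := fun i hi =>
    Prod.ext (Nat.sub_add_cancel (hcol' i hi)) rfl
  have hpin' : P = PsiSet (m - p) (pin (2 * r + 1) w') := by
    rw [← pin_psiWord, ← hpin]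
    refine (pin_congr fun i hi => ?_).symm
    rw [Finset.mem_Icc] at hi
    rw [hww' i (Finset.mem_Icc.2 (by omega)), hww' (i - 1) (Finset.mem_Icc.2 (by omega)),
      hww' (i + 1) (Finset.mem_Icc.2 (by omega))]
    exact ⟨rfl, Iff.rfl⟩
  have hcard' : #(pin (2 * r + 1) w') ≤ r := by
    rwa [← card_psiSet (m - p), ← hpin']
  refine ⟨pin (2 * r + 1) w', ⟨⟨⟨w', ⟨fun i hi => ⟨?_, (hw.1 i hi).2⟩, hw.2⟩, rfl⟩, hcard'⟩, ?_⟩,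
    hpin'⟩
  · have := (hw.1 i hi).1
    simp only [w']
    omega
  · rintro ⟨⟨z, hz, hzdvd, hzpin⟩, -⟩
    refine hnot ⟨⟨psiWord (m - p) z, ?_, ?_, ?_⟩, hcard⟩
    · have := isGenPerm_psiWord (m - p) hz
      rwa [Nat.add_sub_cancel' hple] at this
    · rw [epsSum_psiWord]
      exact dvd_add hzdvd ((Nat.dvd_sub hpm dvd_rfl).mul_left _)
    · rw [pin_psiWord, hzpin, hpin']
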